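/- Assume hypotheses (R1) and (L1), and fix j ∈ {1,…,n−1}. On the open set where u_{nn̄} ≠ 0 (which contains a neighborhood of each point of L) define S = (u_{nn̄})^{−2} u_{n̄jn̄} u_{nj̄n} = (u_{nn̄})^{−2} |u_{jn̄n̄}|². Then at every point of L one has ∂S/∂z_j = (u_{nn̄})^{−2} u_{n̄jn̄j} u_{nj̄n}. -/

import Mathlib

open Complex
open scoped ComplexOrder

/-- Wirtinger derivative in direction `d.1`; `d.2 = true` means `∂/∂z̄`, `false` means `∂/∂z`. -/
noncomputable def wd {n : ℕ} (d : Fin n × Bool) (f : (Fin n → ℂ) → ℂ) : (Fin n → ℂ) → ℂ :=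
  fun z => (1/2 : ℂ) * (fderiv ℝ f z (Pi.single d.1 1) +
      (if d.2 then Complex.I else -Complex.I) * fderiv ℝ f z (Pi.single d.1 Complex.I))

/-- Iterated Wirtinger derivative: differentiate in the listed directions, left to right. -/
noncomputable def wderiv {n : ℕ} (l : List (Fin n × Bool)) (f : (Fin n → ℂ) → ℂ) :
    (Fin n → ℂ) → ℂ :=
  l.foldl (fun g d => wd d g) f

/-- The real function `u` viewed as a complex-valued function. -/
def cplx {n : ℕ} (u : (Fin n → ℂ) → ℝ) : (Fin n → ℂ) → ℂ := fun z => (u z : ℂ)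

/-- Levi matrix entry `u_{jk̄} = ∂²u/∂z_j∂z̄_k`. -/
noncomputable def levi {n : ℕ} (u : (Fin n → ℂ) → ℝ) (j k : Fin n) : (Fin n → ℂ) → ℂ :=
  wderiv [(j, false), (k, true)] (cplx u)

theorem wd_congr_ev {n : ℕ} (d : Fin n × Bool) {f g : (Fin n → ℂ) → ℂ} {z : Fin n → ℂ}
    (h : f =ᶠ[nhds z] g) : wd d f z = wd d g z := by
  simp only [wd, h.fderiv_eq]

theorem wd_congr_on {n : ℕ} (d : Fin n × Bool) {f g : (Fin n → ℂ) → ℂ} {U : Set (Fin n → ℂ)}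
    (hU : IsOpen U) (h : Set.EqOn f g U) : Set.EqOn (wd d f) (wd d g) U := fun z hz =>
  wd_congr_ev d (Filter.eventuallyEq_of_mem (hU.mem_nhds hz) h)

theorem wd_mul {n : ℕ} (d : Fin n × Bool) {f g : (Fin n → ℂ) → ℂ} {z : Fin n → ℂ}
    (hf : DifferentiableAt ℝ f z) (hg : DifferentiableAt ℝ g z) :
    wd d (fun w => f w * g w) z = wd d f z * g z + f z * wd d g z := by
  simp only [wd]
  rw [fderiv_fun_mul hf hg]
  simp only [add_apply, smul_apply, smul_eq_mul]
  ring

theorem wd_add {n : ℕ} (d : Fin n × Bool) {f g : (Fin n → ℂ) → ℂ} {z : Fin n → ℂ}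
    (hf : DifferentiableAt ℝ f z) (hg : DifferentiableAt ℝ g z) :
    wd d (fun w => f w + g w) z = wd d f z + wd d g z := by
  simp only [wd]
  rw [fderiv_fun_add hf hg]
  simp only [add_apply]
  ring

theorem wd_const {n : ℕ} (d : Fin n × Bool) (c : ℂ) (z : Fin n → ℂ) :
    wd d (fun _ => c) z = 0 := by
  simp [wd]

theorem wd_smooth {n : ℕ} (d : Fin n × Bool) {f : (Fin n → ℂ) → ℂ} {U : Set (Fin n → ℂ)}
    (hU : IsOpen U) (hf : ContDiffOn ℝ (⊤ : ℕ∞) f U) : ContDiffOn ℝ (⊤ : ℕ∞) (wd d f) U := by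
  have h : ContDiffOn ℝ (⊤ : ℕ∞) (fderiv ℝ f) U := hf.fderiv_of_isOpen hU (by simp)
  unfold wd
  exact contDiffOn_const.mul ((h.clm_apply contDiffOn_const).add
    (contDiffOn_const.mul (h.clm_apply contDiffOn_const)))

theorem fderiv_wd {n : ℕ} (d : Fin n × Bool) {f : (Fin n → ℂ) → ℂ} {z : Fin n → ℂ}
    (h : DifferentiableAt ℝ (fderiv ℝ f) z) (v : Fin n → ℂ) :
    fderiv ℝ (wd d f) z v = (1/2 : ℂ) * (fderiv ℝ (fderiv ℝ f) z v (Pi.single d.1 1) +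
      (if d.2 then Complex.I else -Complex.I) *
        fderiv ℝ (fderiv ℝ f) z v (Pi.single d.1 Complex.I)) := by
  have h1 : ∀ w : Fin n → ℂ, HasFDerivAt (fun y => fderiv ℝ f y w)
      ((fderiv ℝ (fderiv ℝ f) z).flip w) z := fun w => by
    simpa using h.hasFDerivAt.clm_apply (hasFDerivAt_const w z)
  have h2 := ((h1 (Pi.single d.1 1)).add ((h1 (Pi.single d.1 Complex.I)).const_mul
    (if d.2 then Complex.I else -Complex.I))).const_mul (1/2 : ℂ)
  have h3 : fderiv ℝ (wd d f) z = _ := h2.fderiv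
  rw [h3]
  cases d.2 <;> simp <;> ring

theorem wd_comm {n : ℕ} (d e : Fin n × Bool) {f : (Fin n → ℂ) → ℂ} {U : Set (Fin n → ℂ)}
    (hU : IsOpen U) (hf : ContDiffOn ℝ (⊤ : ℕ∞) f U) :
    Set.EqOn (wd d (wd e f)) (wd e (wd d f)) U := by
  intro z hz
  have h : ContDiffOn ℝ (⊤ : ℕ∞) (fderiv ℝ f) U := hf.fderiv_of_isOpen hU (by simp)
  have hd : DifferentiableAt ℝ (fderiv ℝ f) z :=
    (h.contDiffAt (hU.mem_nhds hz)).differentiableAt (by simp)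
  have hs : IsSymmSndFDerivAt ℝ f z :=
    (hf.contDiffAt (hU.mem_nhds hz)).isSymmSndFDerivAt (by
      simp only [minSmoothness_of_isRCLikeNormedField]
      exact WithTop.coe_le_coe.2 (le_top : (2 : ℕ∞) ≤ ⊤))
  have key : ∀ d e : Fin n × Bool, wd d (wd e f) z = (1/2 : ℂ) * (fderiv ℝ (wd e f) z
      (Pi.single d.1 1) + (if d.2 then Complex.I else -Complex.I) *
      fderiv ℝ (wd e f) z (Pi.single d.1 Complex.I)) := fun d e => rfl
  rw [key, key]
  simp only [fderiv_wd _ hd]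
  rw [hs.eq (Pi.single d.1 1) (Pi.single e.1 1), hs.eq (Pi.single d.1 1) (Pi.single e.1 I),
    hs.eq (Pi.single d.1 I) (Pi.single e.1 1), hs.eq (Pi.single d.1 I) (Pi.single e.1 I)]
  ring

/-- under (R1) and (L1), with S = (u_{nn̄})⁻² u_{n̄jn̄} u_{nj̄n}, along
L = {z_n = 0} one has S_j = (u_{nn̄})⁻² u_{n̄jn̄j} u_{nj̄n}. -/
theorem stmt_6 {m : ℕ} (hm : 1 ≤ m) (U : Set (Fin (m+1) → ℂ)) (hU : IsOpen U)
    (u : (Fin (m+1) → ℂ) → ℝ) (hsmooth : ContDiffOn ℝ (⊤ : ℕ∞) u U)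
    (hR1 : ∀ z ∈ U, ∀ j k : Fin (m+1), j ≠ Fin.last m → k ≠ Fin.last m →
      levi u j k z * levi u (Fin.last m) (Fin.last m) z
        - levi u j (Fin.last m) z * levi u (Fin.last m) k z = 0)
    (hL1 : ∀ z ∈ U, z (Fin.last m) = 0 →
      (∀ j k : Fin (m+1), (j, k) ≠ (Fin.last m, Fin.last m) → levi u j k z = 0) ∧
      0 < (levi u (Fin.last m) (Fin.last m) z).re ∧
      (levi u (Fin.last m) (Fin.last m) z).im = 0)
    (j : Fin (m+1)) (hj : j ≠ Fin.last m) :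
    ∀ z ∈ U, z (Fin.last m) = 0 →
      wd (j, false)
        (fun w => ((levi u (Fin.last m) (Fin.last m) w)⁻¹) ^ 2
          * wderiv [(Fin.last m, true), (j, false), (Fin.last m, true)] (cplx u) w
          * wderiv [(Fin.last m, false), (j, true), (Fin.last m, false)] (cplx u) w) z
      = ((levi u (Fin.last m) (Fin.last m) z)⁻¹) ^ 2
          * wderiv [(Fin.last m, true), (j, false), (Fin.last m, true), (j, false)] (cplx u) z
          * wderiv [(Fin.last m, false), (j, true), (Fin.last m, false)] (cplx u) z := by
  intro z hz hzL
  have hnz : (levi u (Fin.last m) (Fin.last m) z) ≠ 0 := by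
    intro h0
    have := (hL1 z hz hzL).2.1
    rw [h0] at this
    simp at this
  have hP0 : levi u j j z = 0 := (hL1 z hz hzL).1 j j (by simp [hj])
  have hQ0 : levi u j (Fin.last m) z = 0 := (hL1 z hz hzL).1 _ _ (by simp [hj])
  have hR0 : levi u (Fin.last m) j z = 0 := (hL1 z hz hzL).1 _ _ (by simp [hj])
  have hF : ∀ w ∈ U, levi u j j w * levi u (Fin.last m) (Fin.last m) w
        - levi u j (Fin.last m) w * levi u (Fin.last m) j w = 0 :=
    fun w hw => hR1 w hw j j hj hj
  have hf : ContDiffOn ℝ (⊤ : ℕ∞) (cplx u) U := Complex.ofRealCLM.contDiff.comp_contDiffOn hsmooth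
  clear hL1 hR1 hsmooth
  simp only [levi, wderiv, List.foldl_cons, List.foldl_nil] at *
  generalize cplx u = f at *
  generalize ha : (Fin.last m, false) = a at *
  generalize habar : (Fin.last m, true) = abar at *
  generalize hb : (j, false) = b at *
  generalize hbbar : (j, true) = bbar at *
  have sm := fun (d : Fin (m+1) × Bool) {g : (Fin (m+1) → ℂ) → ℂ}
    (hg : ContDiffOn ℝ (⊤ : ℕ∞) g U) => wd_smooth d hU hg
  have df : ∀ {g : (Fin (m+1) → ℂ) → ℂ}, ContDiffOn ℝ (⊤ : ℕ∞) g U → ∀ w ∈ U,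
      DifferentiableAt ℝ g w := fun hg w hw =>
    (hg.contDiffAt (hU.mem_nhds hw)).differentiableAt (by simp)
  -- commutations
  have c1 : wd b (wd abar (wd a f)) z = wd a (wd abar (wd b f)) z := by
    rw [wd_comm b abar hU (sm a hf) hz, wd_congr_on abar hU (wd_comm b a hU hf) hz,
      wd_comm abar a hU (sm b hf) hz]
  have c2 : wd b (wd a (wd bbar (wd a f))) z = wd a (wd a (wd bbar (wd b f))) z := by
    rw [wd_comm b a hU (sm bbar (sm a hf)) hz]
    apply wd_congr_on a hU _ hz
    intro w hw
    rw [wd_comm b bbar hU (sm a hf) hw, wd_congr_on bbar hU (wd_comm b a hU hf) hw,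
      wd_comm bbar a hU (sm b hf) hw]
  have sP := sm bbar (sm b hf)
  have sN := sm abar (sm a hf)
  have sQ := sm abar (sm b hf)
  have sR := sm bbar (sm a hf)
  have sA := sm abar (sm b (sm abar hf))
  generalize wd bbar (wd b f) = P at *
  generalize wd abar (wd a f) = N at *
  generalize wd abar (wd b f) = Q at *
  generalize wd bbar (wd a f) = R at *
  generalize wd abar (wd b (wd abar f)) = A at *
  have hF0 : Set.EqOn (fun w => P w * N w) (fun w => Q w * R w) U :=
    fun w hw => sub_eq_zero.1 (hF w hw)
  have hF1 : Set.EqOn (fun w => wd a P w * N w + P w * wd a N w)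
      (fun w => wd a Q w * R w + Q w * wd a R w) U := by
    intro w hw
    have := wd_congr_on a hU hF0 hw
    rwa [wd_mul a (df sP w hw) (df sN w hw), wd_mul a (df sQ w hw) (df sR w hw)] at this
  have hPn : wd a P z = 0 := by
    have := hF1 hz
    simp only [hP0, hQ0, hR0] at this
    simpa [hnz] using this
  have hF2 := wd_congr_on a hU hF1 hz
  have dP := df sP z hz
  have dN := df sN z hz
  have dQ := df sQ z hz
  have dR := df sR z hz
  have dA := df sA z hz
  have dPa := df (sm a sP) z hz
  have dNa := df (sm a sN) z hz
  have dQa := df (sm a sQ) z hz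
  have dRa := df (sm a sR) z hz
  rw [wd_add a (dPa.fun_mul dN) (dP.fun_mul dNa), wd_add a (dQa.fun_mul dR) (dQ.fun_mul dRa),
    wd_mul a dPa dN, wd_mul a dP dNa, wd_mul a dQa dR, wd_mul a dQ dRa, hP0, hQ0, hR0, hPn] at hF2
  -- inverse
  have dG : DifferentiableAt ℝ (fun w => (N w)⁻¹) z := dN.fun_inv hnz
  have hG : (fun w => (N w)⁻¹ * N w) =ᶠ[nhds z] fun _ => (1 : ℂ) := by
    filter_upwards [dN.continuousAt.eventually_ne hnz] with w hw
    exact inv_mul_cancel₀ hw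
  have hGb := wd_congr_ev b hG
  rw [wd_const, wd_mul b dG dN] at hGb
  simp only [pow_two]
  rw [wd_mul b ((dG.fun_mul dG).fun_mul dA) dRa, wd_mul b (dG.fun_mul dG) dA, wd_mul b dG dG, c2]
  have e1 : wd b (fun w => (N w)⁻¹) z = - (N z)⁻¹ * (N z)⁻¹ * wd b N z := by
    field_simp
    field_simp at hGb
    linear_combination hGb
  have e2 : wd a (wd a P) z = 2 * wd a Q z * wd a R z * (N z)⁻¹ := by
    field_simp
    linear_combination hF2
  rw [e1, e2, c1]
  ring
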